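/- arXiv:1107.5524 — 3 statements merged into one kernel-verified Lean document; each statement's English description precedes it below -/
import Mathlib

section
/- Let (ξⁱ, ωⁱ)_{i=1}^N be a normalized weighted sample and let (ξ̃ʲ)_{j=1}^N be obtained by multinomial resampling, i.e. the ξ̃ʲ are conditionally independent given the σ-algebra F₀ generated by (ξⁱ, ωⁱ)_{i=1}^N and P(ξ̃ʲ = ξⁱ | F₀) = ωⁱ for all i, j. Then for any bounded measurable function h : E → ℝ, Var( ∑_{i=1}^N ωⁱ h(ξⁱ) ) ≤ Var( N^{-1} ∑_{j=1}^N h(ξ̃ʲ) ). -/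
open MeasureTheory ProbabilityTheory Filter

/-- **Variance increase under multinomial resampling.**
If `(ξ̃ʲ)` is obtained from the weighted sample `(ξⁱ, ωⁱ)` by multinomial resampling
(conditionally i.i.d. given the σ-algebra `F₀` generated by `(ξⁱ, ωⁱ)`, with
`P(ξ̃ʲ = ξⁱ | F₀) = ωⁱ`), then for any bounded measurable `h`,
`Var(∑ᵢ ωⁱ h(ξⁱ)) ≤ Var(N⁻¹ ∑ⱼ h(ξ̃ʲ))`. -/
theorem stmt2
    {E : Type*} [MeasurableSpace E] {Ω : Type*} [MeasurableSpace Ω]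
    (μ : Measure Ω) [IsProbabilityMeasure μ]
    (N : ℕ) (hN : 0 < N)
    (ξ : Fin N → Ω → E) (w : Fin N → Ω → ℝ) (ξt : Fin N → Ω → E)
    (hξ : ∀ i, Measurable (ξ i)) (hw : ∀ i, Measurable (w i))
    (hξt : ∀ j, Measurable (ξt j))
    (hwnn : ∀ i, ∀ᵐ ω ∂μ, 0 ≤ w i ω)
    (hwsum : ∀ᵐ ω ∂μ, ∑ i, w i ω = 1)
    -- multinomial resampling: conditionally on `F₀ = σ((ξⁱ, ωⁱ), i ≤ N)`, the `ξ̃ʲ` are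
    -- independent with `P(ξ̃ʲ = ξⁱ | F₀) = ωⁱ`, i.e. for bounded measurable `fⱼ`,
    -- `E[∏ⱼ fⱼ(ξ̃ʲ) | F₀] = ∏ⱼ ∑ᵢ ωⁱ fⱼ(ξⁱ)`
    (hresamp : ∀ (f : Fin N → E → ℝ), (∀ j, Measurable (f j)) →
      (∀ j, ∃ C, ∀ x, |f j x| ≤ C) →
      μ[fun ω => ∏ j, f j (ξt j ω) |
          (⨆ i, MeasurableSpace.comap (ξ i) ‹MeasurableSpace E›) ⊔
            (⨆ i, MeasurableSpace.comap (w i) (inferInstance : MeasurableSpace ℝ))]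
        =ᵐ[μ] fun ω => ∏ j, ∑ i, w i ω * f j (ξ i ω))
    (h : E → ℝ) (hmeas : Measurable h) (hbdd : ∃ C, ∀ x, |h x| ≤ C) :
    variance (fun ω => ∑ i, w i ω * h (ξ i ω)) μ ≤
      variance (fun ω => (∑ j, h (ξt j ω)) / (N : ℝ)) μ := by
  obtain ⟨C, hC⟩ := hbdd
  have hm := sup_le (iSup_le fun i => (hξ i).comap_le) (iSup_le fun i => (hw i).comap_le)
  generalize (⨆ i, MeasurableSpace.comap (ξ i) ‹MeasurableSpace E›) ⊔
    (⨆ i, MeasurableSpace.comap (w i) (inferInstance : MeasurableSpace ℝ)) = m at hm hresamp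
  have hL : ∀ j, MemLp (fun ω => h (ξt j ω)) 2 μ := fun j =>
    MemLp.of_bound (hmeas.comp (hξt j)).aestronglyMeasurable C (ae_of_all _ fun ω => hC _)
  have key : ∀ j, μ[fun ω => h (ξt j ω) | m] =ᵐ[μ] fun ω => ∑ i, w i ω * h (ξ i ω) := by
    intro j
    have h1 := hresamp (fun k => if k = j then h else fun _ => 1)
      (fun k => by split_ifs <;> fun_prop)
      (fun k => by
        split_ifs
        · exact ⟨C, hC⟩
        · exact ⟨1, fun x => by simp⟩)
    have e1 : (fun ω => ∏ k, (if k = j then h else fun _ => 1) (ξt k ω))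
        = fun ω => h (ξt j ω) := by
      funext ω
      rw [Finset.prod_eq_single j (fun b _ hb => by simp [hb]) (by simp)]
      simp
    rw [e1] at h1
    refine h1.trans ?_
    filter_upwards [hwsum] with ω hω
    rw [Finset.prod_eq_single j (fun b _ hb => by simp [hb, hω]) (by simp)]
    simp
  have hN' : (N : ℝ) ≠ 0 := by positivity
  set X : Ω → ℝ := fun ω => (∑ j, h (ξt j ω)) / (N : ℝ) with hX
  have hXe : X = (N : ℝ)⁻¹ • ∑ j, fun ω => h (ξt j ω) := by
    funext ω
    simp [hX, div_eq_inv_mul]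
  have hXL : MemLp X 2 μ := by
    rw [hXe]
    exact (memLp_finsetSum' _ fun j _ => hL j).const_smul _
  have hcond : μ[X | m] =ᵐ[μ] fun ω => ∑ i, w i ω * h (ξ i ω) := by
    rw [hXe]
    have a := condExp_smul (μ := μ) (N : ℝ)⁻¹ (∑ j, fun ω => h (ξt j ω)) m
    have b := condExp_finsetSum (μ := μ) (s := Finset.univ) (f := fun j ω => h (ξt j ω))
      (fun j _ => (hL j).integrable one_le_two) m
    have c := ae_all_iff.2 key
    filter_upwards [a, b, c] with ω a b c
    rw [a, Pi.smul_apply, b, Finset.sum_apply]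
    simp only [c]
    simp [hN']
  rw [← variance_congr hcond]
  have := integral_condVar_add_variance_condExp hm hXL
  have h0 : 0 ≤ μ[Var[X; μ | m]] := by
    refine integral_nonneg_of_ae ?_
    exact condExp_nonneg (ae_of_all _ fun ω => by simp; positivity)
  linarith
end

section
/- Deviation inequality: let (ξ̃ⁱ)_{i=1}^N be E-valued random variables, F̃₀ the σ-algebra they generate, and for each i let (ξ̃ⁱ[k])_{k≥0} be a Markov chain with kernel Q started at ξ̃ⁱ, the N chains being conditionally independent given F̃₀. Then for any bounded measurable function h : E → ℝ, any k ∈ ℕ and any ε > 0, P( | N^{-1} ∑_{i=1}^N h(ξ̃ⁱ[k]) − Π h | > ε ) ≤ 2 exp( − N ε² / (2 (osc h)²) ) + P( | N^{-1} ∑_{i=1}^N Q^k h(ξ̃ⁱ) − Π h | > ε/2 ), where osc h = sup_{u,v ∈ E} |h(u) − h(v)|. -/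
open MeasureTheory ProbabilityTheory Filter

/-- Iterates `Q^k` of a Markov kernel. -/
noncomputable def kIter {E : Type*} [MeasurableSpace E] (Q : Kernel E E) : ℕ → Kernel E E
  | 0 => Kernel.id
  | (n + 1) => (kIter Q n) ∘ₖ Q

/-- `Q^k h (x) = ∫ h(z) Q^k(x, dz)`. -/
noncomputable def kApply {E : Type*} [MeasurableSpace E] (Q : Kernel E E) (k : ℕ)
    (f : E → ℝ) (x : E) : ℝ :=
  ∫ z, f z ∂(kIter Q k x)

theorem kIter_markov {E : Type*} [MeasurableSpace E] (Q : Kernel E E) [IsMarkovKernel Q] (k : ℕ) :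
    IsMarkovKernel (kIter Q k) := by
  induction k with
  | zero => unfold kIter; infer_instance
  | succ n ih => unfold kIter; infer_instance

theorem kApply_meas {E : Type*} [MeasurableSpace E] (Q : Kernel E E) [IsMarkovKernel Q] (k : ℕ)
    (f : E → ℝ) (hf : Measurable f) : Measurable (kApply Q k f) := by
  haveI := kIter_markov Q k
  exact (StronglyMeasurable.integral_kernel (κ := kIter Q k) hf.stronglyMeasurable).measurable

theorem kApply_abs_le {E : Type*} [MeasurableSpace E] (Q : Kernel E E) [IsMarkovKernel Q] (k : ℕ)
    (f : E → ℝ) (C : ℝ) (hC : ∀ x, |f x| ≤ C) (x : E) : |kApply Q k f x| ≤ C := by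
  haveI := kIter_markov Q k
  have := norm_integral_le_of_norm_le_const (μ := kIter Q k x) (f := f) (C := C)
    (Eventually.of_forall hC)
  simpa [kApply] using this

theorem kApply_exp_le {E : Type*} [MeasurableSpace E] (Q : Kernel E E) [IsMarkovKernel Q] (k : ℕ)
    (h : E → ℝ) (hm : Measurable h) (a d : ℝ) (hd : 0 ≤ d) (hab : ∀ x, h x ∈ Set.Icc a (a + d))
    (t : ℝ) (x : E) :
    kApply Q k (fun y => Real.exp (t * h y)) x ≤
      Real.exp (t * kApply Q k h x) * Real.exp (d ^ 2 / 4 * t ^ 2 / 2) := by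
  haveI := kIter_markov Q k
  have H := (hasSubgaussianMGF_of_mem_Icc (μ := kIter Q k x) hm.aemeasurable
    (Eventually.of_forall hab)).mgf_le t
  have e : mgf (fun y => h y - ∫ z, h z ∂(kIter Q k x)) (kIter Q k x) t
      = kApply Q k (fun y => Real.exp (t * h y)) x * Real.exp (-(t * kApply Q k h x)) := by
    unfold mgf kApply
    rw [← integral_mul_const]
    congr 1; ext y
    rw [← Real.exp_add]; congr 1; ring
  rw [e, Real.exp_neg, ← div_eq_mul_inv, div_le_iff₀ (Real.exp_pos _), mul_comm] at H
  refine H.trans (le_of_eq ?_)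
  congr 2
  simp [div_pow]
  norm_num

theorem sum_subG
    {E : Type*} [MeasurableSpace E] {Ω : Type*} [mΩ : MeasurableSpace Ω]
    (μ : Measure Ω) [IsProbabilityMeasure μ]
    (Q : Kernel E E) [IsMarkovKernel Q]
    (N : ℕ)
    (ξ : Fin N → ℕ → Ω → E)
    (hξmeas : ∀ i k, Measurable (ξ i k))
    (hchain : ∀ (k : ℕ) (f : Fin N → E → ℝ), (∀ i, Measurable (f i)) →
      (∀ i, ∃ C, ∀ x, |f i x| ≤ C) →
      μ[fun ω => ∏ i, f i (ξ i k ω) |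
          ⨆ i, MeasurableSpace.comap (ξ i 0) ‹MeasurableSpace E›]
        =ᵐ[μ] fun ω => ∏ i, kApply Q k (f i) (ξ i 0 ω))
    (h : E → ℝ) (hmeas : Measurable h) (C : ℝ) (hC : ∀ x, |h x| ≤ C)
    (k : ℕ) (a d : ℝ) (hd : 0 ≤ d) (hab : ∀ x, h x ∈ Set.Icc a (a + d)) :
    HasSubgaussianMGF (fun ω => ∑ i, (h (ξ i k ω) - kApply Q k h (ξ i 0 ω)))
      (Real.toNNReal (N * (d ^ 2 / 4))) μ := by
  have hkm := kApply_meas Q k h hmeas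
  have hkb := kApply_abs_le Q k h C hC
  have hSm : Measurable (fun ω => ∑ i, (h (ξ i k ω) - kApply Q k h (ξ i 0 ω))) :=
    Finset.measurable_sum _ fun i _ =>
      (hmeas.comp (hξmeas i k)).sub (hkm.comp (hξmeas i 0))
  have hSb : ∀ ω, |∑ i, (h (ξ i k ω) - kApply Q k h (ξ i 0 ω))| ≤ N * (2 * C) := by
    intro ω
    refine (Finset.abs_sum_le_sum_abs _ _).trans ?_
    refine (Finset.sum_le_card_nsmul _ _ (2 * C) ?_).trans (by simp)
    intro i _
    refine (abs_sub _ _).trans ?_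
    linarith [hC (ξ i k ω), hkb (ξ i 0 ω)]
  have bexp : ∀ (t x B : ℝ), |x| ≤ B → |Real.exp (t * x)| ≤ Real.exp (|t| * B) := by
    intro t x B hx
    rw [abs_of_pos (Real.exp_pos _)]
    apply Real.exp_le_exp.2
    refine (le_abs_self _).trans ?_
    rw [abs_mul]
    gcongr
  have hint : ∀ t, Integrable
      (fun ω => Real.exp (t * ∑ i, (h (ξ i k ω) - kApply Q k h (ξ i 0 ω)))) μ := by
    intro t
    refine Integrable.of_bound ((hSm.const_mul t).exp).aestronglyMeasurable
      (Real.exp (|t| * (N * (2 * C)))) (Eventually.of_forall fun ω => ?_)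
    exact bexp t _ _ (hSb ω)
  refine ⟨hint, fun t => ?_⟩
  set m : MeasurableSpace Ω := ⨆ i, MeasurableSpace.comap (ξ i 0) ‹MeasurableSpace E› with hm
  have hle : m ≤ mΩ := iSup_le fun i => (hξmeas i 0).comap_le
  have hξm : ∀ i, Measurable[m] (ξ i 0) := fun i =>
    Measurable.mono (comap_measurable (ξ i 0))
      (le_iSup (fun i => MeasurableSpace.comap (ξ i 0) ‹MeasurableSpace E›) i) le_rfl
  have hch := hchain k (fun _ y => Real.exp (t * h y)) (fun _ => (hmeas.const_mul t).exp)
    (fun _ => ⟨_, fun x => bexp t _ _ (hC x)⟩)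
  have hGm : Measurable[m] (fun ω => Real.exp (-(t * ∑ i, kApply Q k h (ξ i 0 ω)))) := by
    have : Measurable[m] (fun ω => ∑ i, kApply Q k h (ξ i 0 ω)) :=
      Finset.measurable_sum _ fun i _ => hkm.comp (hξm i)
    exact (this.const_mul t).neg.exp
  have hprod : ∀ ω, ∏ i, Real.exp (t * h (ξ i k ω)) = Real.exp (t * ∑ i, h (ξ i k ω)) := by
    intro ω; rw [Finset.mul_sum, Real.exp_sum]
  have hFi : Integrable (fun ω => ∏ i, Real.exp (t * h (ξ i k ω))) μ := by
    simp_rw [hprod]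
    refine Integrable.of_bound (((Finset.measurable_sum _ fun i _ =>
      hmeas.comp (hξmeas i k)).const_mul t).exp).aestronglyMeasurable
      (Real.exp (|t| * (N * C))) (Eventually.of_forall fun ω => ?_)
    refine bexp t _ _ ((Finset.abs_sum_le_sum_abs _ _).trans ?_)
    exact (Finset.sum_le_card_nsmul _ _ C fun i _ => hC _).trans (by simp)
  have heq : (fun ω => Real.exp (t * ∑ i, (h (ξ i k ω) - kApply Q k h (ξ i 0 ω)))) =
      (fun ω => Real.exp (-(t * ∑ i, kApply Q k h (ξ i 0 ω)))) *
        (fun ω => ∏ i, Real.exp (t * h (ξ i k ω))) := by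
    ext ω
    simp only [Pi.mul_apply, hprod, ← Real.exp_add, Finset.sum_sub_distrib]
    congr 1; ring
  have hpull := condExp_mul_of_stronglyMeasurable_left (μ := μ) hGm.stronglyMeasurable
    (heq ▸ hint t) hFi
  unfold mgf
  beta_reduce
  rw [← integral_condExp hle, heq]
  have hbound : ∀ᵐ ω ∂μ, (μ[(fun ω => Real.exp (-(t * ∑ i, kApply Q k h (ξ i 0 ω)))) *
        (fun ω => ∏ i, Real.exp (t * h (ξ i k ω))) | m]) ω ≤
        Real.exp (N * (d ^ 2 / 4) * t ^ 2 / 2) := by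
    filter_upwards [hpull, hch] with ω h1 h2
    rw [h1, Pi.mul_apply, h2]
    have h3 : ∏ i, kApply Q k (fun y => Real.exp (t * h y)) (ξ i 0 ω) ≤
        ∏ i, (Real.exp (t * kApply Q k h (ξ i 0 ω)) * Real.exp (d ^ 2 / 4 * t ^ 2 / 2)) := by
      refine Finset.prod_le_prod (fun i _ => ?_) (fun i _ => ?_)
      · exact integral_nonneg fun y => (Real.exp_pos _).le
      · exact kApply_exp_le Q k h hmeas a d hd hab t _
    refine (mul_le_mul_of_nonneg_left h3 (Real.exp_pos _).le).trans (le_of_eq ?_)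
    rw [Finset.prod_mul_distrib, ← Real.exp_sum, ← Finset.mul_sum, Finset.prod_const, ← mul_assoc,
      ← Real.exp_add, neg_add_cancel, Real.exp_zero, one_mul, ← Real.exp_nat_mul]
    congr 1
    simp
    ring
  refine (integral_mono_ae integrable_condExp (integrable_const _) hbound).trans (le_of_eq ?_)
  rw [Real.coe_toNNReal _ (by positivity)]
  simp

/-- **Proposition 2 (deviation inequality).**
For the `N` conditionally independent Markov chains `(ξ̃ⁱ[k])` with kernel `Q` started
from `ξ̃ⁱ`, for any bounded measurable `h`, any `k` and any `ε > 0`,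
`P(|N⁻¹ ∑ᵢ h(ξ̃ⁱ[k]) − Π h| > ε) ≤ 2 exp(−N ε²/(2 (osc h)²))
  + P(|N⁻¹ ∑ᵢ Q^k h(ξ̃ⁱ) − Π h| > ε/2)`. -/
theorem stmt5
    {E : Type*} [MeasurableSpace E] {Ω : Type*} [MeasurableSpace Ω]
    (μ : Measure Ω) [IsProbabilityMeasure μ]
    (Q : Kernel E E) [IsMarkovKernel Q]
    (π : Measure E) [IsProbabilityMeasure π]
    (hinv : Kernel.Invariant Q π)
    (N : ℕ) (hN : 0 < N)
    -- the `N` Markov chains `ξ i k`, with initial states `ξ i 0 = ξ̃ⁱ`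
    (ξ : Fin N → ℕ → Ω → E)
    (hξmeas : ∀ i k, Measurable (ξ i k))
    -- Markov property and conditional independence given `F̃₀ = σ(ξ̃ⁱ, i ≤ N)`
    (hchain : ∀ (k : ℕ) (f : Fin N → E → ℝ), (∀ i, Measurable (f i)) →
      (∀ i, ∃ C, ∀ x, |f i x| ≤ C) →
      μ[fun ω => ∏ i, f i (ξ i k ω) |
          ⨆ i, MeasurableSpace.comap (ξ i 0) ‹MeasurableSpace E›]
        =ᵐ[μ] fun ω => ∏ i, kApply Q k (f i) (ξ i 0 ω))
    (h : E → ℝ) (hmeas : Measurable h) (hbdd : ∃ C, ∀ x, |h x| ≤ C)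
    (k : ℕ) (ε : ℝ) (hε : 0 < ε) :
    (μ {ω | ε < |(∑ i, h (ξ i k ω)) / (N : ℝ) - ∫ x, h x ∂π|}).toReal ≤
      2 * Real.exp (-((N : ℝ) * ε ^ 2) / (2 * (⨆ p : E × E, |h p.1 - h p.2|) ^ 2))
      + (μ {ω | ε / 2 < |(∑ i, kApply Q k h (ξ i 0 ω)) / (N : ℝ) - ∫ x, h x ∂π|}).toReal := by
  obtain ⟨C, hC⟩ := hbdd
  haveI hne : Nonempty E := by
    obtain ⟨ω⟩ := nonempty_of_isProbabilityMeasure μ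
    exact ⟨ξ ⟨0, hN⟩ 0 ω⟩
  set d := ⨆ p : E × E, |h p.1 - h p.2| with hd
  have hosc : ∀ x y, |h x - h y| ≤ d := by
    intro x y
    refine le_ciSup (f := fun p : E × E => |h p.1 - h p.2|) ⟨2 * C, ?_⟩ (x, y)
    rintro _ ⟨p, rfl⟩
    refine (abs_sub _ _).trans ?_
    linarith [hC p.1, hC p.2]
  have hd0 : 0 ≤ d := (abs_nonneg _).trans (hosc hne.some hne.some)
  have hab : ∀ x, h x ∈ Set.Icc (⨅ y, h y) ((⨅ y, h y) + d) := by
    intro x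
    constructor
    · refine ciInf_le ⟨-C, ?_⟩ x
      rintro _ ⟨y, rfl⟩
      exact (abs_le.1 (hC y)).1
    · have : h x - d ≤ ⨅ y, h y := le_ciInf fun y => by
        linarith [le_abs_self (h x - h y), hosc x y]
      linarith
  have hS := sum_subG μ Q N ξ hξmeas hchain h hmeas C hC k _ d hd0 hab
  have hNpos : (0 : ℝ) < N := by exact_mod_cast hN
  have h1 := hS.measure_ge_le (ε := N * (ε / 2)) (by positivity)
  have h2 := hS.neg.measure_ge_le (ε := N * (ε / 2)) (by positivity)
  have hexp : -(N * (ε / 2)) ^ 2 / (2 * (Real.toNNReal (N * (d ^ 2 / 4)) : ℝ)) =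
      -((N : ℝ) * ε ^ 2) / (2 * d ^ 2) := by
    rw [Real.coe_toNNReal _ (by positivity)]
    rcases eq_or_ne d 0 with h0 | h0
    · simp [h0]
    · field_simp
      norm_num
  rw [hexp] at h1 h2
  have hsub : {ω | ε < |(∑ i, h (ξ i k ω)) / (N : ℝ) - ∫ x, h x ∂π|} ⊆
      ({ω | N * (ε / 2) ≤ ∑ i, (h (ξ i k ω) - kApply Q k h (ξ i 0 ω))} ∪
      {ω | N * (ε / 2) ≤ (-fun ω => ∑ i, (h (ξ i k ω) - kApply Q k h (ξ i 0 ω))) ω}) ∪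
      {ω | ε / 2 < |(∑ i, kApply Q k h (ξ i 0 ω)) / (N : ℝ) - ∫ x, h x ∂π|} := by
    intro ω hω
    by_contra hcon
    simp only [Set.mem_union, Set.mem_setOf_eq, not_or, not_le, not_lt, Pi.neg_apply,
      Finset.sum_sub_distrib] at hcon hω
    obtain ⟨⟨c1, c2⟩, c3⟩ := hcon
    have e1 : |(∑ i, h (ξ i k ω)) / (N : ℝ) - (∑ i, kApply Q k h (ξ i 0 ω)) / (N : ℝ)|
        ≤ ε / 2 := by
      rw [← sub_div, abs_div, abs_of_pos hNpos, div_le_iff₀ hNpos, abs_le]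
      constructor <;> linarith
    have := abs_sub_le ((∑ i, h (ξ i k ω)) / (N : ℝ)) ((∑ i, kApply Q k h (ξ i 0 ω)) / (N : ℝ))
      (∫ x, h x ∂π)
    linarith
  change μ.real _ ≤ _ + μ.real _
  refine (measureReal_mono hsub).trans ((measureReal_union_le _ _).trans ?_)
  have h3 := measureReal_union_le (μ := μ)
    {ω | N * (ε / 2) ≤ ∑ i, (h (ξ i k ω) - kApply Q k h (ξ i 0 ω))}
    {ω | N * (ε / 2) ≤ (-fun ω => ∑ i, (h (ξ i k ω) - kApply Q k h (ξ i 0 ω))) ω}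
  linarith
end

section
/- Vanishing of the bias term in the CLT proof: assume there are a measurable V : E → [1,∞) and β ∈ (0,1) such that |Q^k h(x) − Π h| ≤ ‖h/V‖_∞ β^k V(x) for all x ∈ E, k ∈ ℕ, that ‖h/V‖_∞ < ∞, that { N^{-1} ∑_{i=1}^N V(ξ̃^{i,N}) }_{N≥1} is bounded in probability, and that k_N are integers with k_N + ln N/(2 ln β) → ∞ as N → ∞. Then N^{-1/2} ∑_{i=1}^N ( Q^{k_N} h(ξ̃^{i,N}) − Π h ) converges to 0 in probability. -/
open MeasureTheory ProbabilityTheory Filter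

/-- **Vanishing bias term in the proof of the CLT.**
If `|Q^k h(x) − Π h| ≤ ‖h/V‖∞ β^k V(x)` with `‖h/V‖∞ < ∞`, if `N⁻¹ ∑ᵢ V(ξ̃^{i,N})` is
bounded in probability and `k_N + ln N/(2 ln β) → ∞`, then
`N^{-1/2} ∑ᵢ (Q^{k_N} h(ξ̃^{i,N}) − Π h) → 0` in probability. -/
theorem stmt8
    {E : Type*} [MeasurableSpace E] {Ω : Type*} [MeasurableSpace Ω]
    (μ : Measure Ω) [IsProbabilityMeasure μ]
    (Q : Kernel E E) [IsMarkovKernel Q]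
    (π : Measure E) [IsProbabilityMeasure π]
    (hinv : Kernel.Invariant Q π)
    (V : E → ℝ) (hVmeas : Measurable V) (hV1 : ∀ x, 1 ≤ V x)
    (β : ℝ) (hβ0 : 0 < β) (hβ1 : β < 1)
    -- `h` with `‖h/V‖∞ ≤ c < ∞` and the geometric bound `|Q^k h(x) − Π h| ≤ c β^k V(x)`
    (h : E → ℝ) (hmeas : Measurable h)
    (c : ℝ) (hc : ∀ x, |h x| ≤ c * V x)
    (hgeo : ∀ (k : ℕ) (x : E), |kApply Q k h x - ∫ z, h z ∂π| ≤ c * β ^ k * V x)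
    -- the triangular array `ξ̃^{i,N}`
    (ξ : (N : ℕ) → Fin N → Ω → E)
    (hξmeas : ∀ N i, Measurable (ξ N i))
    -- `N⁻¹ ∑ᵢ V(ξ̃^{i,N})` is bounded in probability
    (hbip : ∀ δ : ℝ, 0 < δ → ∃ M : ℝ, ∀ N : ℕ,
      μ {ω | M < (∑ i, V (ξ N i ω)) / (N : ℝ)} ≤ ENNReal.ofReal δ)
    (kN : ℕ → ℕ)
    (hkN : Tendsto (fun N : ℕ => (kN N : ℝ) + Real.log N / (2 * Real.log β)) atTop atTop) :
    ∀ ε : ℝ, 0 < ε →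
      Tendsto (fun N : ℕ =>
          μ {ω | ε < |(∑ i, (kApply Q (kN N) h (ξ N i ω) - ∫ z, h z ∂π)) / Real.sqrt N|})
        atTop (nhds (0 : ENNReal)) := by
  intro ε hε
  have hlog : Real.log β < 0 := Real.log_neg hβ0 hβ1
  have ha : Tendsto (fun N : ℕ => β ^ (kN N) * Real.sqrt N) atTop (nhds 0) := by
    have h1 := Real.tendsto_exp_atBot.comp (hkN.const_mul_atTop_of_neg hlog)
    refine h1.congr' ?_
    filter_upwards [eventually_gt_atTop 0] with N hN
    have hN' : (0 : ℝ) < N := by exact_mod_cast hN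
    have e1 : Real.log β * ((kN N : ℝ) + Real.log N / (2 * Real.log β))
        = (kN N : ℝ) * Real.log β + Real.log N / 2 := by
      field_simp [hlog.ne]
    simp only [Function.comp]
    rw [e1, Real.exp_add, Real.exp_nat_mul, Real.exp_log hβ0, ← Real.log_sqrt hN'.le,
      Real.exp_log (Real.sqrt_pos.2 hN')]
  rw [ENNReal.tendsto_nhds_zero]
  intro d hd
  have hm0 : min d 1 ≠ 0 := (lt_min hd one_pos).ne'
  have hmt : min d 1 ≠ ⊤ := ne_top_of_le_ne_top ENNReal.one_ne_top (min_le_right _ _)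
  obtain ⟨M, hM⟩ := hbip (min d 1).toReal (ENNReal.toReal_pos hm0 hmt)
  have hb : Tendsto (fun N : ℕ => |c| * (β ^ (kN N) * Real.sqrt N) * |M|) atTop (nhds 0) := by
    simpa using (ha.const_mul |c|).mul_const |M|
  filter_upwards [eventually_gt_atTop 0, hb.eventually (gt_mem_nhds hε)] with N hN hlt
  have hN' : (0 : ℝ) < N := by exact_mod_cast hN
  have hs : 0 < Real.sqrt N := Real.sqrt_pos.2 hN'
  refine le_trans (le_trans (measure_mono ?_) (hM N)) ?_
  · intro ω hω
    simp only [Set.mem_setOf_eq] at hω ⊢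
    by_contra hcon
    push Not at hcon
    have hsum : |∑ i, (kApply Q (kN N) h (ξ N i ω) - ∫ z, h z ∂π)|
        ≤ |c| * β ^ (kN N) * ∑ i, V (ξ N i ω) := by
      rw [Finset.mul_sum]
      refine (Finset.abs_sum_le_sum_abs _ _).trans (Finset.sum_le_sum fun i _ => ?_)
      refine (hgeo _ _).trans ?_
      have := hV1 (ξ N i ω)
      have hp : 0 < β ^ (kN N) := pow_pos hβ0 _
      gcongr
      exact le_abs_self c
    have h2 : (∑ i, V (ξ N i ω)) ≤ |M| * N := by
      rw [div_le_iff₀ hN'] at hcon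
      exact hcon.trans (by gcongr; exact le_abs_self M)
    rw [abs_div, abs_of_pos hs, lt_div_iff₀ hs] at hω
    have h3 : |c| * β ^ (kN N) * ∑ i, V (ξ N i ω) ≤ |c| * β ^ (kN N) * (|M| * N) := by
      gcongr
    have h4 : |c| * β ^ (kN N) * (|M| * N)
        = (|c| * (β ^ (kN N) * Real.sqrt N) * |M|) * Real.sqrt N := by
      have := Real.mul_self_sqrt hN'.le
      linear_combination (-(|c| * β ^ (kN N) * |M|)) * this
    have h5 := mul_lt_mul_of_pos_right hlt hs
    linarith
  · rw [ENNReal.ofReal_toReal hmt]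
    exact min_le_left _ _
end
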